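/- (Principle of change of rings.) Let R be a one-dimensional Cohen–Macaulay local ring with canonical module K_R and let I be a fractional ideal of R with FI = F such that I ⊗_R Hom_R(I, K_R) is torsionfree. If there exists an intermediate ring R ⊆ S ⊆ B, where B = I : I, such that I ≅ S or I ≅ K_S as an S-module (K_S = Hom_R(S, K_R)), then I ≅ R or I ≅ K_R as an R-module. -/

import Mathlib

open CategoryTheory TensorProduct

set_option synthInstance.maxHeartbeats 1000000
set_option maxHeartbeats 2000000

noncomputable section

/-- Minimal number of generators of a submodule. -/
def minGen (R : Type*) {M : Type*} [Semiring R] [AddCommMonoid M] [Module R M]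
    (p : Submodule R M) : ℕ :=
  sInf {n | ∃ s : Finset M, s.card = n ∧ Submodule.span R (s : Set M) = p}

/-- Length of a module, as the height of `⊤` in its lattice of submodules. -/
def moduleLength (R M : Type*) [Ring R] [AddCommGroup M] [Module R M] : ℕ∞ :=
  Order.height (⊤ : Submodule R M)

/-- `e` is the (Hilbert–Samuel) multiplicity of the one-dimensional local ring `(R, m)`:
the first difference of the Hilbert–Samuel function `n ↦ ℓ_R(R/mⁿ)` is eventually
equal to `e`. -/
def IsMultiplicityAt (R : Type*) [CommRing R] (m : Ideal R) (e : ℕ) : Prop :=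
  ∃ N : ℕ, ∀ n ≥ N,
    moduleLength R (R ⧸ (m ^ (n + 1))) = moduleLength R (R ⧸ (m ^ n)) + e

/-- The `i`-th Ext module `Ext_R^i(M, N)`. -/
def extMod (R : Type u) [CommRing R] (M N : ModuleCat.{u} R) (i : ℕ) : ModuleCat R :=
  ((Ext R (ModuleCat.{u} R) i).obj (Opposite.op M)).obj N

/-- `K` is a canonical module of the one-dimensional Cohen–Macaulay local ring `R` with
maximal ideal `m`, via the Bass-number characterization:
`Ext^i(R/m, K) = 0` for `i ≠ 1` and `Ext^1(R/m, K) ≅ R/m`. -/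
def IsCanonicalModuleAt (R : Type u) [CommRing R] (m : Ideal R)
    (K : Type u) [AddCommGroup K] [Module R K] : Prop :=
  Module.Finite R K ∧
  (∀ i : ℕ, i ≠ 1 →
    Subsingleton (extMod R (ModuleCat.of R (R ⧸ m)) (ModuleCat.of R K) i)) ∧
  Nonempty ((extMod R (ModuleCat.of R (R ⧸ m)) (ModuleCat.of R K) 1) ≅
    ModuleCat.of R (R ⧸ m))

/-- The evaluation map `I ⊗_R Hom_R(I, K) → K`, `x ⊗ f ↦ f x`. -/
def evalMap (R : Type*) [CommRing R] {M : Type*} [AddCommGroup M] [Module R M]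
    (I : Submodule R M) (K : Type*) [AddCommGroup K] [Module R K] :
    (I ⊗[R] (I →ₗ[R] K)) →ₗ[R] K :=
  TensorProduct.lift LinearMap.applyₗ

/-- A fractional ideal `I` of `R` with `FI = F`: a finitely generated `R`-submodule of the
total ring of fractions `F = Q(R)` containing a unit of `F`. -/
def IsFracIdealUnit (R : Type*) [CommRing R] (I : Submodule R (FractionRing R)) : Prop :=
  I.FG ∧ ∃ x ∈ I, IsUnit x

/-- A one-dimensional Cohen–Macaulay local ring: Noetherian, local, Krull dimension one,
and the maximal ideal contains a nonzerodivisor. -/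
def IsOneDimCMLocal (R : Type*) [CommRing R] [IsLocalRing R] : Prop :=
  IsNoetherianRing R ∧ ringKrullDim R = 1 ∧
    ∃ x ∈ IsLocalRing.maximalIdeal R, x ∈ nonZeroDivisors R

/-- The colon `M : N = {x ∈ A | x N ⊆ M}` of two `R`-submodules of an `R`-algebra `A`,
as an `R`-submodule of `A`. -/
def colonSub {R A : Type*} [CommRing R] [CommRing A] [Algebra R A]
    (M N : Submodule R A) : Submodule R A where
  carrier := {x : A | ∀ y ∈ N, x * y ∈ M}
  add_mem' := fun {a b} ha hb y hy => by
    rw [add_mul]; exact M.add_mem (ha y hy) (hb y hy)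
  zero_mem' := fun y hy => by rw [zero_mul]; exact M.zero_mem
  smul_mem' := fun c {x} hx y hy => by
    rw [smul_mul_assoc]; exact M.smul_mem c (hx y hy)


/-- If the `R`-submodule `I` of `A` is stable under multiplication by the subalgebra `S`
(i.e. `S ⊆ I : I`), then `I` may be viewed as an `S`-submodule of `A`. -/
def restrictUp {R A : Type*} [CommRing R] [CommRing A] [Algebra R A]
    (S : Subalgebra R A) (I : Submodule R A)
    (h : ∀ s ∈ S, ∀ y ∈ I, s * y ∈ I) : Submodule S A where
  carrier := I
  add_mem' := fun {a b} ha hb => I.add_mem ha hb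
  zero_mem' := I.zero_mem
  smul_mem' := fun c {x} hx => by
    have hc : (c : A) * x ∈ I := h (c : A) c.2 x hx
    simpa [Algebra.smul_def] using hc

/-- The natural `S`-scalar action on `K_S = Hom_R(S, K)`, with `(s • f) x = f (s x)`. -/
instance canonicalHomSMul {R A : Type*} [CommRing R] [CommRing A] [Algebra R A]
    (S : Subalgebra R A) (K : Type*) [AddCommGroup K] [Module R K] :
    SMul S (↥S →ₗ[R] K) :=
  ⟨fun s f => f ∘ₗ LinearMap.mulLeft R s⟩

theorem canonicalHomSMul_apply {R A : Type*} [CommRing R] [CommRing A] [Algebra R A]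
    {S : Subalgebra R A} {K : Type*} [AddCommGroup K] [Module R K]
    (s : S) (f : ↥S →ₗ[R] K) (x : S) : (s • f) x = f (s * x) := rfl

/-- The natural `S`-module structure on `K_S = Hom_R(S, K)`, with `(s • f) x = f (s x)`. -/
instance canonicalHomModule {R A : Type*} [CommRing R] [CommRing A] [Algebra R A]
    (S : Subalgebra R A) (K : Type*) [AddCommGroup K] [Module R K] :
    Module S (↥S →ₗ[R] K) where
  smul := (· • ·)
  one_smul f := LinearMap.ext fun x => by
    rw [canonicalHomSMul_apply, one_mul]
  mul_smul s t f := LinearMap.ext fun x => by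
    rw [canonicalHomSMul_apply, canonicalHomSMul_apply, canonicalHomSMul_apply,
      mul_comm s t, mul_assoc]
  smul_zero s := LinearMap.ext fun x => rfl
  smul_add s f g := LinearMap.ext fun x => rfl
  add_smul s t f := LinearMap.ext fun x => by
    rw [LinearMap.add_apply, canonicalHomSMul_apply, canonicalHomSMul_apply,
      canonicalHomSMul_apply, add_mul, map_add]
  zero_smul f := LinearMap.ext fun x => by
    rw [canonicalHomSMul_apply, zero_mul, map_zero, LinearMap.zero_apply]

theorem subsingleton_linearMap_of_extMod_zero (R : Type u) [CommRing R] (M N : Type u)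
    [AddCommGroup M] [Module R M] [AddCommGroup N] [Module R N]
    (h : Subsingleton (extMod R (ModuleCat.of R M) (ModuleCat.of R N) 0)) :
    Subsingleton (M →ₗ[R] N) := by
  let G := (linearYoneda R (ModuleCat.{u} R)).obj (ModuleCat.of R N)
  have : Limits.PreservesFiniteLimits (G ⋙ forget (ModuleCat R)) :=
    inferInstanceAs (Limits.PreservesFiniteLimits (yoneda.obj (ModuleCat.of R N)))
  have : Limits.PreservesFiniteLimits G :=
    Limits.preservesFiniteLimits_of_reflects_of_preserves G (forget (ModuleCat R))
  have : Limits.PreservesFiniteColimits G.rightOp := Limits.preservesFiniteColimits_rightOp G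
  let e := (G.rightOp.leftDerivedZeroIsoSelf.app (ModuleCat.of R M)).unop
  have h1 : Subsingleton (ModuleCat.of R M ⟶ ModuleCat.of R N) :=
    e.toLinearEquiv.toEquiv.subsingleton_congr.mpr h
  exact (ModuleCat.homEquiv (M := ModuleCat.of R M) (N := ModuleCat.of R N)).symm.subsingleton

theorem exists_linearMap_residueField_ne_zero (R M : Type*) [CommRing R] [IsLocalRing R]
    [AddCommGroup M] [Module R M] [Module.Finite R M] [Nontrivial M] :
    ∃ f : M →ₗ[R] IsLocalRing.ResidueField R, f ≠ 0 := by
  have : Nontrivial (IsLocalRing.ResidueField R ⊗[R] M) := by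
    rw [← not_subsingleton_iff_nontrivial, IsLocalRing.subsingleton_tensorProduct]
    exact not_subsingleton M
  obtain ⟨v, hv⟩ := exists_ne (0 : IsLocalRing.ResidueField R ⊗[R] M)
  obtain ⟨g, hg⟩ := Module.Projective.exists_dual_ne_zero (IsLocalRing.ResidueField R) hv
  refine ⟨g.restrictScalars R ∘ₗ TensorProduct.mk R _ M 1, fun h => hg ?_⟩
  have h1 (y : M) : g (1 ⊗ₜ y) = 0 := LinearMap.congr_fun h y
  have h0 : g = 0 := by
    ext y
    exact h1 y
  simp [h0]

/-- If `M ⊗ N` is torsionfree and every `n : N` becomes, up to a nonzerodivisor, a multiple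
of `n₀` in a way compatible with the elements of `M`, then `n₀` generates `N`. -/
theorem span_singleton_eq_top_of_torsion_tensorProduct_eq_bot
    {R M N : Type*} [CommRing R] [IsLocalRing R]
    [AddCommGroup M] [Module R M] [Module.Finite R M] [Nontrivial M]
    [AddCommGroup N] [Module R N] [Module.Finite R N]
    (htf : Submodule.torsion R (M ⊗[R] N) = ⊥) (n₀ : N)
    (h : ∀ (n : N) (y : M), ∃ r ∈ nonZeroDivisors R, ∃ (a : R) (y' : M),
      r • n = a • n₀ ∧ r • y' = a • y) :
    Submodule.span R {n₀} = ⊤ := by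
  by_contra hne
  have : Nontrivial (N ⧸ Submodule.span R {n₀}) := Submodule.Quotient.nontrivial_iff.mpr hne
  obtain ⟨f, hf⟩ := exists_linearMap_residueField_ne_zero R M
  obtain ⟨g, hg⟩ := exists_linearMap_residueField_ne_zero R (N ⧸ Submodule.span R {n₀})
  obtain ⟨y, hy⟩ := DFunLike.ne_iff.mp hf
  obtain ⟨q, hq⟩ := DFunLike.ne_iff.mp hg
  obtain ⟨n, rfl⟩ := Submodule.mkQ_surjective _ q
  obtain ⟨r, hr, a, y', h1, h2⟩ := h n y
  have key : y ⊗ₜ[R] n - y' ⊗ₜ[R] n₀ = 0 := by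
    rw [← Submodule.mem_bot R, ← htf, Submodule.mem_torsion_iff]
    refine ⟨⟨r, hr⟩, ?_⟩
    rw [Submonoid.mk_smul, smul_sub, ← TensorProduct.tmul_smul, h1, TensorProduct.tmul_smul,
      TensorProduct.smul_tmul', TensorProduct.smul_tmul', h2, sub_self]
  let φ := LinearMap.mul' R (IsLocalRing.ResidueField R) ∘ₗ
    TensorProduct.map f (g ∘ₗ Submodule.mkQ (Submodule.span R {n₀}))
  have h0 : (Submodule.span R {n₀}).mkQ n₀ = 0 := by simp
  have := congrArg φ key
  simp only [φ, map_sub, LinearMap.comp_apply, TensorProduct.map_tmul, LinearMap.mul'_apply, h0,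
    map_zero, mul_zero, sub_zero] at this
  exact (mul_ne_zero hy hq) this

theorem exists_smul_ne_zero_of_subsingleton_linearMap {R : Type*} [CommRing R] [IsLocalRing R]
    [IsNoetherianRing R] (hdim : ringKrullDim R = 1) {K : Type*} [AddCommGroup K] [Module R K]
    [Nontrivial K] (hK : Subsingleton (R ⧸ IsLocalRing.maximalIdeal R →ₗ[R] K))
    {r : R} (hr : r ∈ nonZeroDivisors R) : ∃ z : K, r • z ≠ 0 := by
  by_contra! hz
  obtain ⟨p, hp⟩ := associatedPrimes.nonempty R K
  obtain ⟨hpp, x, hx⟩ := Submodule.isAssociatedPrime_iff.mp hp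
  have hann (a : R) : a ∈ p ↔ a • x = 0 := by
    rw [hx, Submodule.mem_colon_singleton, Submodule.mem_bot]
  have hd : Ring.KrullDimLE 1 R := Ring.krullDimLE_iff.mpr hdim.le
  have hpm : p.IsMaximal := by
    refine ((Ring.krullDimLE_one_iff.mp hd) p hpp).resolve_left fun hmin => ?_
    exact notMem_nonZeroDivisors_of_mem_mem_minimalPrimes ((hann r).mpr (hz x)) hmin hr
  rw [IsLocalRing.eq_maximalIdeal hpm] at hann
  let f := (IsLocalRing.maximalIdeal R).liftQ (LinearMap.toSpanSingleton R K x)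
    fun a ha => (hann a).mp ha
  have hf := LinearMap.congr_fun (Subsingleton.elim f 0) (Submodule.Quotient.mk 1)
  have : (1 : R) • x = 0 := hf
  exact (Ideal.ne_top_iff_one _).mp (IsLocalRing.maximalIdeal.isMaximal R).ne_top
    ((hann 1).mpr this)

theorem subsingleton_extMod_of_subsingleton (R : Type u) [CommRing R] (M : ModuleCat.{u} R)
    (N : Type u) [AddCommGroup N] [Module R N] [Subsingleton N] (i : ℕ) :
    Subsingleton (extMod R M (ModuleCat.of R N) i) := by
  refine ModuleCat.subsingleton_of_isZero
    (Limits.IsZero.of_iso ?_ ((projectiveResolution M).isoExt i (ModuleCat.of R N)))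
  rw [← HomologicalComplex.exactAt_iff_isZero_homology, HomologicalComplex.exactAt_iff]
  refine ShortComplex.exact_of_isZero_X₂ _ ?_
  rw [Limits.IsZero.iff_id_eq_zero]
  ext (x : _ ⟶ _)
  exact (ModuleCat.isZero_of_subsingleton (ModuleCat.of R N)).eq_of_tgt _ _

theorem exists_smul_eq_algebraMap {R : Type*} [CommRing R] (x : FractionRing R) :
    ∃ r ∈ nonZeroDivisors R, ∃ a : R, r • x = algebraMap R (FractionRing R) a := by
  obtain ⟨⟨a, r⟩, h⟩ := IsLocalization.surj (nonZeroDivisors R) x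
  exact ⟨r, r.2, a, by rw [Algebra.smul_def, mul_comm, h]⟩

theorem isUnit_algebraMap_fractionRing {R : Type*} [CommRing R] {r : R}
    (hr : r ∈ nonZeroDivisors R) : IsUnit (algebraMap R (FractionRing R) r) :=
  IsLocalization.map_units (FractionRing R) (⟨r, hr⟩ : nonZeroDivisors R)

/-- A linear endomorphism of a fractional ideal is multiplication by a fraction. -/
theorem exists_smul_apply_eq_smul {R : Type*} [CommRing R] {I : Submodule R (FractionRing R)}
    (hI : ∃ x ∈ I, IsUnit x) (φ : I →ₗ[R] I) :
    ∃ r ∈ nonZeroDivisors R, ∃ a : R, ∀ y, r • φ y = a • y := by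
  obtain ⟨u, hu, hunit⟩ := hI
  obtain ⟨v, hv⟩ := hunit.exists_right_inv
  obtain ⟨r, hr, a, hra⟩ := exists_smul_eq_algebraMap ((φ ⟨u, hu⟩ : FractionRing R) * v)
  refine ⟨r, hr, a, fun y => ?_⟩
  obtain ⟨q, hq, p, hqp⟩ := exists_smul_eq_algebraMap ((y : FractionRing R) * v)
  have h1 : q • y = p • (⟨u, hu⟩ : I) := by
    apply Subtype.ext
    simp only [Submodule.coe_smul, Algebra.smul_def] at hqp ⊢
    linear_combination u * hqp - algebraMap R _ q * y * hv
  have h2 : r • φ ⟨u, hu⟩ = a • (⟨u, hu⟩ : I) := by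
    apply Subtype.ext
    simp only [Submodule.coe_smul, Algebra.smul_def] at hra ⊢
    linear_combination u * hra - algebraMap R _ r * (φ ⟨u, hu⟩ : FractionRing R) * hv
  have h3 : q • (r • φ y) = q • (a • y) := by
    rw [smul_comm, ← map_smul, h1, map_smul, smul_comm, h2, smul_comm q a, h1, smul_comm]
  apply Subtype.ext
  have h4 := congrArg Subtype.val h3
  simp only [Submodule.coe_smul, Algebra.smul_def] at h4 ⊢
  exact (isUnit_algebraMap_fractionRing hq).mul_left_cancel h4

theorem nontrivial_of_exists_isUnit {R : Type*} [CommRing R] [Nontrivial R]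
    {I : Submodule R (FractionRing R)} (hI : ∃ x ∈ I, IsUnit x) : Nontrivial I := by
  obtain ⟨u, hu, hunit⟩ := hI
  exact ⟨⟨u, hu⟩, 0, fun h => hunit.ne_zero (congrArg Subtype.val h)⟩

theorem nontrivial_linearMap_of_isFracIdealUnit {R : Type*} [CommRing R]
    {I : Submodule R (FractionRing R)} (hI : IsFracIdealUnit R I)
    {K : Type*} [AddCommGroup K] [Module R K]
    (hK : ∀ r ∈ nonZeroDivisors R, ∃ z : K, r • z ≠ 0) : Nontrivial (I →ₗ[R] K) := by
  obtain ⟨hfg, u, hu, hunit⟩ := hI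
  obtain ⟨r, hr, hrI⟩ := FractionalIdeal.isFractional_of_fg (S := nonZeroDivisors R) hfg
  have hinj := IsFractionRing.injective R (FractionRing R)
  let f : I →ₗ[R] R :=
    (LinearEquiv.ofInjective (Algebra.linearMap R (FractionRing R)) hinj).symm ∘ₗ
      (r • I.subtype).codRestrict (LinearMap.range (Algebra.linearMap R (FractionRing R)))
      fun y => hrI y y.2
  have hf : algebraMap R (FractionRing R) (f ⟨u, hu⟩) = r • u :=
    LinearEquiv.ofInjective_symm_apply (Algebra.linearMap R (FractionRing R)) (h := hinj) _
  have ha : f ⟨u, hu⟩ ∈ nonZeroDivisors R := by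
    refine mem_nonZeroDivisors_of_injective (f := algebraMap R (FractionRing R)) hinj ?_
    rw [hf, Algebra.smul_def]
    exact ((isUnit_algebraMap_fractionRing hr).mul hunit).mem_nonZeroDivisors
  obtain ⟨z, hz⟩ := hK _ ha
  exact ⟨LinearMap.toSpanSingleton R K z ∘ₗ f, 0, fun h => hz (LinearMap.congr_fun h ⟨u, hu⟩)⟩

/-- Multiplication by `s` as an endomorphism of a submodule stable under it. -/
def mulEnd {R A : Type*} [CommRing R] [CommRing A] [Algebra R A] (I : Submodule R A) (s : A)
    (h : ∀ y ∈ I, s * y ∈ I) : I →ₗ[R] I :=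
  (LinearMap.mulLeft R s).restrict h

theorem nonempty_linearEquiv_of_equiv_subalgebra {R : Type*} [CommRing R] [IsLocalRing R]
    [IsNoetherianRing R] {K : Type*} [AddCommGroup K] [Module R K] [Module.Finite R K]
    (hK : ∀ r ∈ nonZeroDivisors R, ∃ z : K, r • z ≠ 0)
    {I : Submodule R (FractionRing R)} (hI : IsFracIdealUnit R I)
    (htf : Submodule.torsion R (↥I ⊗[R] (↥I →ₗ[R] K)) = ⊥)
    {S : Subalgebra R (FractionRing R)} (hS : ∀ s ∈ S, ∀ y ∈ I, s * y ∈ I)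
    (e : ↥(restrictUp S I hS) ≃ₗ[S] S) : Nonempty (↥I ≃ₗ[R] R) := by
  have : Module.Finite R I := Module.Finite.iff_fg.mpr hI.1
  have := nontrivial_linearMap_of_isFracIdealUnit hI hK
  let n₀ : I := e.symm 1
  have hmul (y : I) : ((e y : S) : FractionRing R) * n₀ = y := by
    have : e y • e.symm 1 = y := by
      rw [← map_smul, smul_eq_mul, mul_one]
      exact e.symm_apply_apply y
    exact congrArg Subtype.val this
  have htf' : Submodule.torsion R ((↥I →ₗ[R] K) ⊗[R] ↥I) = ⊥ := by
    rw [eq_bot_iff]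
    intro t ht
    obtain ⟨r, hr⟩ := (Submodule.mem_torsion_iff t).mp ht
    have : TensorProduct.comm R _ _ t ∈ Submodule.torsion R (↥I ⊗[R] (↥I →ₗ[R] K)) := by
      refine (Submodule.mem_torsion_iff _).mpr ⟨r, ?_⟩
      rw [Submonoid.smul_def] at hr ⊢
      rw [← map_smul, hr, map_zero]
    rw [htf, Submodule.mem_bot] at this
    simpa using this
  have hspan := span_singleton_eq_top_of_torsion_tensorProduct_eq_bot htf' n₀ fun n y => by
    obtain ⟨r, hr, a, ha⟩ := exists_smul_eq_algebraMap ((e n : S) : FractionRing R)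
    refine ⟨r, hr, a, y ∘ₗ mulEnd I (e n : S) (hS _ (e n).2), ?_, ?_⟩
    · apply Subtype.ext
      rw [Submodule.coe_smul, Submodule.coe_smul, ← hmul n, ← smul_mul_assoc, ha,
        Algebra.smul_def]
    · ext z
      rw [LinearMap.smul_apply, LinearMap.smul_apply, LinearMap.comp_apply, ← map_smul y,
        ← map_smul y]
      congr 1
      apply Subtype.ext
      change r • (((e n : S) : FractionRing R) * z) = a • (z : FractionRing R)
      rw [← smul_mul_assoc, ha, Algebra.smul_def]
  refine ⟨(LinearEquiv.ofBijective (LinearMap.toSpanSingleton R I n₀) ⟨?_, ?_⟩).symm⟩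
  · rw [injective_iff_map_eq_zero]
    intro a ha
    have h1 : algebraMap R S a • e.symm 1 = 0 := by
      apply Subtype.ext
      have := congrArg Subtype.val ha
      rw [LinearMap.toSpanSingleton_apply, Submodule.coe_smul, Algebra.smul_def] at this
      exact this
    rw [← map_smul, LinearEquiv.map_eq_zero_iff, smul_eq_mul, mul_one] at h1
    exact IsFractionRing.injective R (FractionRing R)
      ((congrArg Subtype.val h1).trans (map_zero _).symm)
  · rw [← LinearMap.range_eq_top, LinearMap.range_toSpanSingleton, hspan]

theorem nonempty_linearEquiv_of_equiv_canonicalHom {R : Type*} [CommRing R] [IsLocalRing R]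
    [IsNoetherianRing R] {K : Type*} [AddCommGroup K] [Module R K] [Module.Finite R K]
    {I : Submodule R (FractionRing R)} (hI : IsFracIdealUnit R I)
    (htf : Submodule.torsion R (↥I ⊗[R] (↥I →ₗ[R] K)) = ⊥)
    {S : Subalgebra R (FractionRing R)} (hS : ∀ s ∈ S, ∀ y ∈ I, s * y ∈ I)
    (e : ↥(restrictUp S I hS) ≃ₗ[S] (↥S →ₗ[R] K)) : Nonempty (↥I ≃ₗ[R] K) := by
  have : Module.Finite R I := Module.Finite.iff_fg.mpr hI.1
  have := nontrivial_of_exists_isUnit hI.2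
  let μ (s : S) : I →ₗ[R] I := mulEnd I s (hS s s.2)
  let E : I ≃+ (S →ₗ[R] K) := e.toAddEquiv
  have hE (s : S) (y : I) : E (μ s y) = s • E y := e.map_smul s y
  have hμ (a : R) (y : I) : μ (algebraMap R S a) y = a • y :=
    Subtype.ext (Algebra.smul_def a (y : FractionRing R)).symm
  have hsmul (a : R) (f : S →ₗ[R] K) : algebraMap R S a • f = a • f := by
    ext x
    rw [canonicalHomSMul_apply, ← Algebra.smul_def, map_smul, LinearMap.smul_apply]
  let L : I ≃ₗ[R] (S →ₗ[R] K) :=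
    { E with
      map_smul' := fun a y => by
        change E (a • y) = a • E y
        rw [← hμ, hE, hsmul] }
  have hL (s : S) (y : I) (t : S) : L (μ s y) t = L y (s * t) :=
    LinearMap.congr_fun (hE s y) t
  let δ₀ : I →ₗ[R] K := LinearMap.applyₗ 1 ∘ₗ L.toLinearMap
  have hδ₀ (y : I) : δ₀ y = L y 1 := rfl
  let φ (δ : I →ₗ[R] K) : I →ₗ[R] I :=
    L.symm.toLinearMap ∘ₗ
      { toFun := fun y =>
          { toFun := fun s => δ (μ s y)
            map_add' := fun s t => by
              rw [← map_add]
              exact congrArg δ (Subtype.ext (add_mul (s : FractionRing R) t y))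
            map_smul' := fun a s => by
              rw [RingHom.id_apply, ← map_smul]
              exact congrArg δ (Subtype.ext (smul_mul_assoc a (s : FractionRing R) y)) }
        map_add' := fun y z => by ext s; simp
        map_smul' := fun a y => by ext s; simp }
  have hφ (δ : I →ₗ[R] K) (y : I) : δ₀ (φ δ y) = δ y := by
    simp only [hδ₀, φ, LinearMap.comp_apply, LinearEquiv.coe_coe, LinearEquiv.apply_symm_apply]
    exact congrArg δ (Subtype.ext (one_mul (y : FractionRing R)))
  have hspan := span_singleton_eq_top_of_torsion_tensorProduct_eq_bot htf δ₀ fun δ y => by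
    obtain ⟨r, hr, a, ha⟩ := exists_smul_apply_eq_smul hI.2 (φ δ)
    refine ⟨r, hr, a, φ δ y, ?_, ha y⟩
    ext z
    rw [LinearMap.smul_apply, LinearMap.smul_apply, ← hφ δ z, ← map_smul, ha, map_smul]
  have hsurj : Function.Surjective (algebraMap R S) := by
    intro s
    have hs : δ₀ ∘ₗ μ s ∈ Submodule.span R {δ₀} := hspan ▸ Submodule.mem_top
    obtain ⟨r, hr⟩ := Submodule.mem_span_singleton.mp hs
    obtain ⟨u, hu, hunit⟩ := hI.2
    have h1 : μ (algebraMap R S r) ⟨u, hu⟩ = μ s ⟨u, hu⟩ := by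
      apply L.injective
      ext t
      have : r • δ₀ (μ t ⟨u, hu⟩) = δ₀ (μ s (μ t ⟨u, hu⟩)) :=
        LinearMap.congr_fun hr (μ t ⟨u, hu⟩)
      rw [← map_smul δ₀, ← hμ] at this
      simp only [hδ₀, hL, mul_one] at this
      rwa [hL, hL, mul_comm _ t, mul_comm _ t]
    exact ⟨r, Subtype.ext (hunit.mul_right_cancel (congrArg Subtype.val h1))⟩
  have hinj : Function.Injective (algebraMap R S) := fun a b hab =>
    IsFractionRing.injective R (FractionRing R) (congrArg Subtype.val hab)
  let σ : R ≃ₗ[R] S := LinearEquiv.ofBijective (Algebra.linearMap R S) ⟨hinj, hsurj⟩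
  exact ⟨L ≪≫ₗ σ.symm.congrLeft K R ≪≫ₗ LinearMap.ringLmapEquivSelf R R K⟩

/-- (Principle of change of rings, Proposition 2.2) Let `R` be a
one-dimensional Cohen–Macaulay local ring with canonical module `K`, and `I` a fractional
ideal with `FI = F` such that `I ⊗_R Hom_R(I, K)` is torsionfree. If there is an
intermediate ring `R ⊆ S ⊆ B = I : I` such that `I ≅ S` or `I ≅ K_S = Hom_R(S, K)` as an
`S`-module, then `I ≅ R` or `I ≅ K` as an `R`-module. -/
theorem stmt2 (R : Type u) [CommRing R] [IsLocalRing R]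
    (hCM : IsOneDimCMLocal R)
    (K : Type u) [AddCommGroup K] [Module R K]
    (hK : IsCanonicalModuleAt R (IsLocalRing.maximalIdeal R) K)
    (I : Submodule R (FractionRing R)) (hI : IsFracIdealUnit R I)
    (htf : Submodule.torsion R (↥I ⊗[R] (↥I →ₗ[R] K)) = ⊥)
    (S : Subalgebra R (FractionRing R)) (hS : ∀ s ∈ S, ∀ y ∈ I, s * y ∈ I)
    (hiso : Nonempty (↥(restrictUp S I hS) ≃ₗ[S] S) ∨
      Nonempty (↥(restrictUp S I hS) ≃ₗ[S] (↥S →ₗ[R] K))) :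
    Nonempty (↥I ≃ₗ[R] R) ∨ Nonempty (↥I ≃ₗ[R] K) := by
  obtain ⟨hN, hdim, -⟩ := hCM
  obtain ⟨hfin, hzero, ⟨e₁⟩⟩ := hK
  rcases hiso with ⟨⟨e⟩⟩ | ⟨⟨e⟩⟩
  · have : Nontrivial K := by
      by_contra hK
      rw [not_nontrivial_iff_subsingleton] at hK
      have := subsingleton_extMod_of_subsingleton R
        (ModuleCat.of R (R ⧸ IsLocalRing.maximalIdeal R)) K 1
      have : Subsingleton (R ⧸ IsLocalRing.maximalIdeal R) :=
        e₁.toLinearEquiv.symm.toEquiv.subsingleton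
      exact not_subsingleton (IsLocalRing.ResidueField R) this
    have hHom := subsingleton_linearMap_of_extMod_zero R _ _ (hzero 0 zero_ne_one)
    exact Or.inl (nonempty_linearEquiv_of_equiv_subalgebra
      (fun r hr => exists_smul_ne_zero_of_subsingleton_linearMap hdim hHom hr) hI htf hS e)
  · exact Or.inr (nonempty_linearEquiv_of_equiv_canonicalHom hI htf hS e)

end
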